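/- arXiv:1709.00607 — 3 statements merged into one kernel-verified Lean document; each statement's English description precedes it below -/
import Mathlib

section
/- Suppose m ≡ 2 (mod 4). Define b = −(1/m)·Σ_{j ∈ J} ∏_{k=1}^n C_{j_k}(α_j(k)) ∈ ℚ. Then b ≠ 0 and −ν(b) = ⌊(2/3)(m+1)⌋ − s(⌊(2/3)(m+1)⌋) + ε(m), where ε(m) = 0 if m ≡ 22 (mod 24) and ε(m) = 1 otherwise. (Zagier's conjecture; by the Ewing–Schober formula, b equals the m-th Laurent coefficient b_m of the conformal map from the exterior of the unit disk onto the complement of the Mandelbrot set.) -/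
open Finset

/-- `s a` is the sum of the binary digits of `a`. -/
def sdig (a : ℕ) : ℕ := (Nat.digits 2 a).sum

/-- `carries a b` is the number of carries when adding `a` and `b` in base 2:
`c(a,b) = s(a) + s(b) - s(a+b)`. -/
def carries (a b : ℕ) : ℕ := sdig a + sdig b - sdig (a + b)

/-- The generalized binomial coefficient `C_r(x) = x(x-1)⋯(x-r+1)/r!` (with `C_0(x) = 1`). -/
def genBinom (x : ℚ) (r : ℕ) : ℚ :=
  (∏ p ∈ Finset.range r, (x - p)) / (Nat.factorial r : ℚ)

/-- Membership in the index set `J`: here `j i` (for `i : Fin n`) is the paper's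
`j_{i+1}`, so the defining relation `(2^n-1)j_1 + ⋯ + (2-1)j_n = m+1` becomes
`∑ k, (2^(n-k) - 1) * j k = m + 1`. -/
def inJ (n m : ℕ) (j : Fin n → ℕ) : Prop :=
  ∑ k : Fin n, (2 ^ (n - (k : ℕ)) - 1) * j k = m + 1

/-- `α_j(k)`: for `K : Fin n`, `alphaF n m j K` is the paper's `α_j(K+1)`, i.e.
`m / 2^(n-K) - ∑_{I < K} 2^(K-I) j_{I+1}`. -/
def alphaF (n m : ℕ) (j : Fin n → ℕ) (K : Fin n) : ℚ :=
  (m : ℚ) / 2 ^ (n - (K : ℕ)) -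
    ∑ I : Fin n, if (I : ℕ) < (K : ℕ) then 2 ^ ((K : ℕ) - (I : ℕ)) * (j I : ℚ) else 0

/-- `P(j) = ∏_{k=1}^n C_{j_k}(α_j(k))`. -/
def Pprod (n m : ℕ) (j : Fin n → ℕ) : ℚ :=
  ∏ k : Fin n, genBinom (alphaF n m j k) (j k)

/-- `V(j) = -ν(P(j))`, where `ν` is the 2-adic valuation on `ℚ`. -/
def V (n m : ℕ) (j : Fin n → ℕ) : ℤ := - padicValRat 2 (Pprod n m j)

/-- The set `J` as a `Finset` (each coordinate of a tuple in `J` is at most `m+1`). -/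
def Jset (n m : ℕ) : Finset (Fin n → ℕ) :=
  (Fintype.piFinset fun _ : Fin n => Finset.range (m + 2)).filter
    fun j => ∑ k : Fin n, (2 ^ (n - (k : ℕ)) - 1) * j k = m + 1

lemma sdig_le (a : ℕ) : sdig a ≤ a := Nat.digit_sum_le 2 a

lemma sdig_two_mul (a : ℕ) : sdig (2 * a) = sdig a := by
  rcases Nat.eq_zero_or_pos a with rfl | h
  · simp
  · simp [sdig, Nat.digits_def' (by norm_num : 1 < 2) (by omega : 0 < 2 * a)]

lemma sdig_two_mul_add_one (a : ℕ) : sdig (2 * a + 1) = sdig a + 1 := by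
  have h : (2 * a + 1) / 2 = a := by omega
  have h' : (2 * a + 1) % 2 = 1 := by omega
  rw [sdig, Nat.digits_def' (by norm_num : 1 < 2) (by omega : 0 < 2 * a + 1), h, h']
  simp [sdig, add_comm]

lemma padicValNat_factorial_two (a : ℕ) : padicValNat 2 a.factorial = a - sdig a := by
  simpa [sdig] using sub_one_mul_padicValNat_factorial (p := 2) a

lemma sdig_add_le (a b : ℕ) : sdig (a + b) ≤ sdig a + sdig b := by
  have h := (padicValNat_dvd_iff_le (p := 2) (a := (a + b).factorial)
    (n := padicValNat 2 (a.factorial * b.factorial)) (Nat.factorial_ne_zero _)).1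
    (pow_padicValNat_dvd.trans (Nat.factorial_mul_factorial_dvd_factorial_add a b))
  rw [padicValNat.mul (Nat.factorial_ne_zero _) (Nat.factorial_ne_zero _),
    padicValNat_factorial_two, padicValNat_factorial_two, padicValNat_factorial_two] at h
  have := sdig_le a
  have := sdig_le b
  have := sdig_le (a + b)
  omega

lemma two_mul_sdig_le (a : ℕ) : 2 * sdig a ≤ a + 1 := by
  induction a using Nat.strong_induction_on with
  | _ a ih =>
    obtain ⟨k, rfl | rfl⟩ := Nat.even_or_odd' a
    · rcases Nat.eq_zero_or_pos k with rfl | h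
      · simp [sdig]
      · have := ih k (by omega)
        rw [sdig_two_mul]
        omega
    · have := sdig_le k
      rw [sdig_two_mul_add_one]
      omega

lemma sdig_pos {a : ℕ} (h : 0 < a) : 0 < sdig a := by
  induction a using Nat.strong_induction_on with
  | _ a ih =>
    obtain ⟨k, rfl | rfl⟩ := Nat.even_or_odd' a
    · rw [sdig_two_mul]
      exact ih k (by omega) (by omega)
    · rw [sdig_two_mul_add_one]
      omega

lemma padicNorm_two_odd {z : ℤ} (h : Odd z) : padicNorm 2 (z : ℚ) = 1 :=
  (padicNorm.int_eq_one_iff z).2 fun h2 => by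
    rw [Nat.cast_ofNat, ← even_iff_two_dvd] at h2
    exact (Int.not_even_iff_odd.2 h) h2

lemma padicNorm_two_two : padicNorm 2 (2 : ℚ) = 1 / 2 := by
  simpa using padicNorm.padicNorm_p (p := 2) (by norm_num)

lemma padicNorm_two_pow (e : ℕ) : padicNorm 2 ((2 : ℚ) ^ e) = (2 ^ e)⁻¹ := by
  induction e with
  | zero => simp
  | succ k ih => rw [pow_succ, padicNorm.mul, ih, padicNorm_two_two]; field_simp

lemma padicNorm_two_factorial (r : ℕ) :
    padicNorm 2 (r.factorial : ℚ) = ((2 : ℚ) ^ (r - sdig r))⁻¹ := by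
  rw [padicNorm.eq_zpow_of_nonzero (by exact_mod_cast r.factorial_ne_zero),
    padicValRat.of_nat, padicValNat_factorial_two]
  simp

lemma padicNorm_two_prod {ι : Type*} (s : Finset ι) (f : ι → ℚ) :
    padicNorm 2 (∏ i ∈ s, f i) = ∏ i ∈ s, padicNorm 2 (f i) := by
  classical
  induction s using Finset.induction_on with
  | empty => simp
  | insert a s ha ih => rw [prod_insert ha, prod_insert ha, padicNorm.mul, ih]

/-- The 2-adic size of a binomial coefficient whose upper entry is an odd integer over `2 ^ e`. -/
lemma padicNorm_genBinom {e : ℕ} (he : 1 ≤ e) {c : ℤ} (hc : Odd c) (r : ℕ) :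
    padicNorm 2 (genBinom (c / 2 ^ e) r) = 2 ^ ((e + 1) * r - sdig r) := by
  have h (p : ℕ) : padicNorm 2 ((c : ℚ) / 2 ^ e - p) = 2 ^ e := by
    have hodd : Odd (c - 2 ^ e * p : ℤ) :=
      hc.sub_even (((Int.even_pow.2 ⟨even_two, by omega⟩)).mul_right _)
    have : (c : ℚ) / 2 ^ e - p = ((c - 2 ^ e * p : ℤ) : ℚ) / 2 ^ e := by
      push_cast
      field_simp
    rw [this, padicNorm.div, padicNorm_two_odd hodd, padicNorm_two_pow, div_inv_eq_mul, one_mul]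
  rw [genBinom, padicNorm.div, padicNorm_two_prod, padicNorm_two_factorial]
  simp only [h, prod_const, card_range, div_inv_eq_mul]
  rw [← pow_mul, ← pow_add]
  congr 1
  have := sdig_le r
  have : (e + 1) * r = e * r + r := by ring
  omega

lemma padicNorm_genBinom_int_le (z : ℤ) (r : ℕ) : padicNorm 2 (genBinom z r) ≤ 1 := by
  have : genBinom z r = ((Ring.choose z r : ℤ) : ℚ) := by
    rw [genBinom, div_eq_iff (by exact_mod_cast r.factorial_ne_zero), mul_comm]
    have h := Ring.descPochhammer_eq_factorial_smul_choose z r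
    have h2 : ((Polynomial.smeval (descPochhammer ℤ r) z : ℤ) : ℚ) =
        ∏ p ∈ range r, ((z : ℚ) - p) := by
      rw [← Polynomial.eval_eq_smeval, descPochhammer_eval_eq_prod_range]
      push_cast
      rfl
    rw [← h2, h]
    simp
  rw [this]
  exact padicNorm.of_int _

lemma padicNorm_two_add_lt {x y : ℚ} (hx : x ≠ 0) (h : padicNorm 2 x = padicNorm 2 y) :
    padicNorm 2 (x + y) < padicNorm 2 x := by
  have hx' : padicNorm 2 x ≠ 0 := padicNorm.nonzero hx
  have key : padicNorm 2 (1 + y / x) < 1 := by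
    set z := y / x with hz
    have hz1 : padicNorm 2 z = 1 := by rw [hz, padicNorm.div, ← h, div_self hx']
    have hcop := z.reduced
    have hden : Odd (z.den : ℤ) := by
      by_contra hd
      have hd2 : 2 ∣ z.den := by
        rw [Int.not_odd_iff_even, even_iff_two_dvd] at hd
        exact_mod_cast hd
      have hnum : ¬ (2 : ℤ) ∣ z.num := fun hn => by
        have := Nat.dvd_gcd (Int.natCast_dvd.1 (by exact_mod_cast hn : ((2 : ℕ) : ℤ) ∣ z.num)) hd2
        rw [hcop] at this
        omega
      have e : padicNorm 2 (z.num : ℚ) = padicNorm 2 z * padicNorm 2 (z.den : ℚ) := by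
        rw [← padicNorm.mul, Rat.mul_den_eq_num]
      rw [hz1, one_mul, (padicNorm.int_eq_one_iff z.num).2 (by exact_mod_cast hnum)] at e
      have := (padicNorm.nat_lt_one_iff (p := 2) z.den).2 hd2
      linarith
    have hd1 : padicNorm 2 (z.den : ℚ) = 1 := by exact_mod_cast padicNorm_two_odd hden
    have e : padicNorm 2 (z.num : ℚ) = 1 := by
      rw [← Rat.mul_den_eq_num z, padicNorm.mul, hz1, hd1, one_mul]
    have hnum : Odd z.num := by
      rw [padicNorm.int_eq_one_iff] at e
      rw [← Int.not_even_iff_odd, even_iff_two_dvd]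
      exact_mod_cast e
    have hs : 1 + z = ((z.den + z.num : ℤ) : ℚ) / z.den := by
      push_cast
      rw [add_div, Rat.num_div_den, div_self (by exact_mod_cast z.den_nz)]
    rw [hs, padicNorm.div, hd1, div_one, padicNorm.int_lt_one_iff]
    exact_mod_cast (hden.add_odd hnum).two_dvd
  have : x + y = x * (1 + y / x) := by field_simp
  rw [this, padicNorm.mul]
  have : 0 < padicNorm 2 x := lt_of_le_of_ne (padicNorm.nonneg _) hx'.symm
  nlinarith

lemma alphaF_eq (n : ℕ) (c : ℕ) (j : Fin n → ℕ) (K : Fin n) :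
    alphaF n (2 * c) j K = (((c : ℤ) - 2 ^ (n - (K : ℕ) - 1) *
      ∑ I : Fin n, if (I : ℕ) < (K : ℕ) then 2 ^ ((K : ℕ) - (I : ℕ)) * (j I : ℤ) else 0 : ℤ) : ℚ) /
        2 ^ (n - (K : ℕ) - 1) := by
  obtain ⟨e, he⟩ : ∃ e, n - (K : ℕ) = e + 1 := ⟨n - K - 1, by omega⟩
  rw [alphaF, he]
  push_cast
  rw [sub_div, mul_div_cancel_left₀ _ (by positivity), pow_succ]
  congr 1
  field_simp

lemma odd_alphaF_num (n : ℕ) {c : ℕ} (hc : Odd c) (j : Fin n → ℕ) (K : Fin n) (e : ℕ) :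
    Odd ((c : ℤ) - 2 ^ e *
      ∑ I : Fin n, if (I : ℕ) < (K : ℕ) then 2 ^ ((K : ℕ) - (I : ℕ)) * (j I : ℤ) else 0 : ℤ) := by
  refine Odd.sub_even (by exact_mod_cast hc) (Even.mul_left ?_ _)
  refine Finset.even_sum _ fun I _ => ?_
  split_ifs with h
  · exact (Int.even_pow.2 ⟨even_two, by omega⟩).mul_right _
  · simp

/-- The exponent contributed by the entries `j_1, …, j_{n-2}` to the 2-adic size of `P(j)`. -/
def headExp (N : ℕ) (a : Fin (N + 1) → ℕ) : ℕ :=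
  ∑ K : Fin (N + 1), ((N + 3 - (K : ℕ)) * a K - sdig (a K))

/-- The contribution of the entries `j_1, …, j_{n-2}` to the linear relation defining `J`. -/
def headWeight (N : ℕ) (a : Fin (N + 1) → ℕ) : ℕ :=
  ∑ K : Fin (N + 1), (2 ^ (N + 3 - (K : ℕ)) - 1) * a K

/-- The tuple `(a, x, y)`. -/
def tuple (N : ℕ) (a : Fin (N + 1) → ℕ) (x y : ℕ) : Fin (N + 3) → ℕ :=
  Fin.snoc (α := fun _ => ℕ) (Fin.snoc (α := fun _ => ℕ) a x) y

lemma exists_eq_tuple {N : ℕ} (j : Fin (N + 3) → ℕ) : ∃ a x y, j = tuple N a x y :=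
  ⟨Fin.init (α := fun _ => ℕ) (Fin.init (α := fun _ => ℕ) j), j (Fin.last _).castSucc,
    j (Fin.last _), by
    have h : Fin.init (α := fun _ => ℕ) j (Fin.last _) = j (Fin.last _).castSucc := rfl
    rw [tuple, ← h, Fin.snoc_init_self, Fin.snoc_init_self]⟩

lemma mem_Jset_tuple {N m : ℕ} {a : Fin (N + 1) → ℕ} {x y : ℕ} :
    tuple N a x y ∈ Jset (N + 3) m ↔ headWeight N a + 3 * x + y = m + 1 := by
  have hsum (j : Fin (N + 3) → ℕ) (k : Fin (N + 3)) :
      j k ≤ ∑ k : Fin (N + 3), (2 ^ (N + 3 - (k : ℕ)) - 1) * j k := by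
    refine le_trans ?_ (Finset.single_le_sum
      (f := fun k : Fin (N + 3) => (2 ^ (N + 3 - (k : ℕ)) - 1) * j k)
      (fun _ _ => Nat.zero_le _) (mem_univ k))
    have : 2 ^ 1 ≤ 2 ^ (N + 3 - (k : ℕ)) := Nat.pow_le_pow_right (by norm_num) (by omega)
    exact Nat.le_mul_of_pos_left _ (by omega)
  have heq : ∑ k : Fin (N + 3), (2 ^ (N + 3 - (k : ℕ)) - 1) * tuple N a x y k =
      headWeight N a + 3 * x + y := by
    have h1 : N + 3 - (N + 1) = 2 := by omega
    have h2 : N + 3 - (N + 2) = 1 := by omega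
    rw [Fin.sum_univ_castSucc, Fin.sum_univ_castSucc]
    simp [tuple, headWeight, h1, h2]
  rw [Jset, mem_filter, heq, Fintype.mem_piFinset]
  refine ⟨And.right, fun h => ⟨fun k => mem_range.2 ?_, h⟩⟩
  have := hsum (tuple N a x y) k
  omega

lemma padicNorm_Pprod_tuple {N c : ℕ} (hc : Odd c) (a : Fin (N + 1) → ℕ) (x y : ℕ) :
    ∃ z : ℤ, Odd z ∧ (a = 0 → z = c - 2 * x) ∧
      padicNorm 2 (Pprod (N + 3) (2 * c) (tuple N a x y)) =
        2 ^ (headExp N a + (2 * x - sdig x)) * padicNorm 2 (genBinom z y) := by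
  refine ⟨_, odd_alphaF_num (N + 3) hc (tuple N a x y) (Fin.last _) 0, ?_, ?_⟩
  · rintro rfl
    rw [Fin.sum_univ_castSucc, Fin.sum_univ_castSucc]
    simp [tuple]
  · have h (K : Fin (N + 3)) (hK : (K : ℕ) < N + 2) :
        padicNorm 2 (genBinom (alphaF (N + 3) (2 * c) (tuple N a x y) K) (tuple N a x y K)) =
          2 ^ ((N + 3 - (K : ℕ)) * tuple N a x y K - sdig (tuple N a x y K)) := by
      rw [alphaF_eq, padicNorm_genBinom (by omega) (odd_alphaF_num _ hc _ _ _),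
        Nat.sub_add_cancel (by omega)]
    rw [Pprod, padicNorm_two_prod, Fin.prod_univ_castSucc, Fin.prod_univ_castSucc]
    congr 1
    · rw [pow_add, headExp, ← prod_pow_eq_pow_sum]
      congr 1
      · refine prod_congr rfl fun K _ => ?_
        rw [h _ (by simp; omega)]
        simp [tuple]
      · rw [h _ (by simp)]
        have h1 : N + 3 - (N + 1) = 2 := by omega
        simp [tuple, h1]
    · rw [alphaF_eq]
      have h2 : N + 3 - (N + 2) - 1 = 0 := by omega
      simp only [Fin.val_last, h2, pow_zero, div_one]
      congr 2
      simp [tuple]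

lemma headExp_zero (N : ℕ) : headExp N 0 = 0 := by simp [headExp]

lemma headWeight_zero (N : ℕ) : headWeight N 0 = 0 := by simp [headWeight]

lemma headExp_single (N : ℕ) : headExp N (Pi.single (Fin.last N) 1) = 2 := by
  rw [headExp, Finset.sum_eq_single (Fin.last N)]
  · simp [sdig]
  · intro K _ hK
    simp [hK]
  · simp

lemma headWeight_single (N : ℕ) : headWeight N (Pi.single (Fin.last N) 1) = 7 := by
  rw [headWeight, Finset.sum_eq_single (Fin.last N)]
  · simp
  · intro K _ hK
    simp [hK]
  · simp

lemma seven_mul_le {l : ℕ} (hl : 3 ≤ l) : 7 * l ≤ 3 * (2 ^ l - 1) := by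
  induction l, hl using Nat.le_induction with
  | base => norm_num
  | succ k hk ih =>
    have : 2 ^ 3 ≤ 2 ^ k := Nat.pow_le_pow_right (by norm_num) hk
    rw [pow_succ]
    omega

lemma headExp_le {N : ℕ} {a : Fin (N + 1) → ℕ} (ha : a ≠ 0) :
    7 * (headExp N a + 1) ≤ 3 * headWeight N a := by
  have key : 7 * (headExp N a + ∑ K, sdig (a K)) ≤ 3 * headWeight N a := by
    rw [headExp, headWeight, ← sum_add_distrib, mul_sum, mul_sum]
    refine sum_le_sum fun K _ => ?_
    have h1 := sdig_le (a K)
    have h2 : 1 * a K ≤ (N + 3 - (K : ℕ)) * a K := Nat.mul_le_mul_right _ (by omega)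
    have h3 := Nat.mul_le_mul_right (a K) (seven_mul_le (l := N + 3 - K) (by omega))
    rw [Nat.sub_add_cancel (by omega), ← mul_assoc, ← mul_assoc]
    exact h3
  obtain ⟨K, hK⟩ := Function.ne_iff.1 ha
  have h1 := sdig_pos (Nat.pos_of_ne_zero hK)
  have h2 := Finset.single_le_sum (f := fun K => sdig (a K)) (fun _ _ => Nat.zero_le _)
    (mem_univ K)
  omega

lemma eq_zero_or_eq_single {N : ℕ} {a : Fin (N + 1) → ℕ} (h : headWeight N a < 14) :
    a = 0 ∨ a = Pi.single (Fin.last N) 1 := by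
  have hle (K : Fin (N + 1)) : (2 ^ (N + 3 - (K : ℕ)) - 1) * a K < 14 :=
    lt_of_le_of_lt (Finset.single_le_sum
      (f := fun K : Fin (N + 1) => (2 ^ (N + 3 - (K : ℕ)) - 1) * a K)
      (fun _ _ => Nat.zero_le _) (mem_univ K)) h
  have h0 (K : Fin (N + 1)) (hK : K ≠ Fin.last N) : a K = 0 := by
    by_contra h0
    have hlt : (K : ℕ) < N := Fin.val_lt_last hK
    have : 2 ^ 4 ≤ 2 ^ (N + 3 - (K : ℕ)) := Nat.pow_le_pow_right (by norm_num) (by omega)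
    have := Nat.le_mul_of_pos_right (2 ^ (N + 3 - (K : ℕ)) - 1) (Nat.pos_of_ne_zero h0)
    have := hle K
    omega
  have hlast : a (Fin.last N) = 0 ∨ a (Fin.last N) = 1 := by
    have := hle (Fin.last N)
    have h1 : N + 3 - N = 3 := by omega
    rw [Fin.val_last, h1] at this
    omega
  refine hlast.imp (fun hl => ?_) fun hl => ?_
  all_goals
    ext K
    by_cases hK : K = Fin.last N
    · subst hK; simp [hl]
    · simp [hK, h0 K hK]

lemma sdig_values : sdig 1 = 1 ∧ sdig 2 = 1 ∧ sdig 3 = 2 ∧ sdig 4 = 1 ∧ sdig 5 = 2 ∧ sdig 6 = 2 := by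
  simp [sdig]

/-- Every tuple in `J` other than `(0, q, r)` has exponent less than `2q - s(q)`. If `r = 2`, only
two of them can have exponent `2q - s(q) - 1`. -/
lemma exponent_bound {N m q r x y : ℕ} {a : Fin (N + 1) → ℕ} (hq : m + 1 = 3 * q + r) (hr : r < 3)
    (h : headWeight N a + 3 * x + y = m + 1) :
    (a = 0 ∧ x = q ∧ y = r) ∨
    (a = 0 ∧ x + 1 = q ∧ y = r + 3) ∨
    (a = Pi.single (Fin.last N) 1 ∧ x + 2 = q ∧ y + 1 = r) ∨
    headExp N a + (2 * x - sdig x) + 2 ≤ 2 * q - sdig q ∨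
    (r < 2 ∧ headExp N a + (2 * x - sdig x) + 1 ≤ 2 * q - sdig q) := by
  obtain ⟨u, rfl⟩ : ∃ u, q = x + u := ⟨q - x, by omega⟩
  have h1 := sdig_add_le x u
  have h2 := two_mul_sdig_le u
  have h3 := sdig_le x
  have h4 := sdig_le (x + u)
  by_cases ha : a = 0
  · subst ha
    rw [headWeight_zero] at h
    rw [headExp_zero]
    simp only [true_and]
    omega
  have h5 := headExp_le ha
  by_cases hw : headWeight N a < 14
  · obtain h6 | h6 := eq_zero_or_eq_single hw
    · exact absurd h6 ha
    subst h6
    rw [headWeight_single] at h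
    rw [headExp_single]
    simp only [true_and]
    obtain ⟨s1, s2, s3, s4, s5, s6⟩ := sdig_values
    by_cases hu : u = 2
    · subst hu
      omega
    · omega
  · have hu : u = 4 ∨ u = 5 ∨ u = 6 ∨ 7 ≤ u := by omega
    obtain ⟨s1, s2, s3, s4, s5, s6⟩ := sdig_values
    rcases hu with rfl | rfl | rfl | hu <;> omega

lemma genBinom_zero (x : ℚ) : genBinom x 0 = 1 := by simp [genBinom]

lemma genBinom_one (x : ℚ) : genBinom x 1 = x := by simp [genBinom]

lemma genBinom_two (x : ℚ) : genBinom x 2 = x * (x - 1) / 2 := by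
  simp [genBinom, prod_range_succ]

lemma genBinom_five (x : ℚ) :
    genBinom x 5 = x * (x - 1) * (x - 2) * (x - 3) * (x - 4) / 120 := by
  simp [genBinom, prod_range_succ, Nat.factorial]

lemma padicNorm_Pprod_le {N c : ℕ} (hc : Odd c) (a : Fin (N + 1) → ℕ) (x y : ℕ) :
    padicNorm 2 (Pprod (N + 3) (2 * c) (tuple N a x y)) ≤
      2 ^ (headExp N a + (2 * x - sdig x)) := by
  obtain ⟨z, -, -, h⟩ := padicNorm_Pprod_tuple hc a x y
  rw [h]
  exact mul_le_of_le_one_right (by positivity) (padicNorm_genBinom_int_le z y)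

lemma padicNorm_sum_eq_of_dominant {ι : Type*} [DecidableEq ι] {s : Finset ι} {f : ι → ℚ} {i : ι}
    (hi : i ∈ s) {t : ℚ} (ht : 0 < t) (hf : padicNorm 2 (f i) = t)
    (h : ∀ k ∈ s, k ≠ i → padicNorm 2 (f k) < t) : padicNorm 2 (∑ k ∈ s, f k) = t := by
  rw [← Finset.add_sum_erase s f hi]
  have hlt : padicNorm 2 (∑ k ∈ s.erase i, f k) < t :=
    padicNorm.sum_lt' (fun k hk => h k (mem_of_mem_erase hk) (ne_of_mem_erase hk)) ht
  rw [padicNorm.add_eq_max_of_ne (by rw [hf]; exact hlt.ne'), hf, max_eq_left hlt.le]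

lemma padicNorm_sum_generic {N c q r : ℕ} (hc : Odd c) (hq : 2 * c + 1 = 3 * q + r) (hr : r < 3)
    (h : ¬ (r = 2 ∧ q % 8 = 7)) :
    padicNorm 2 (∑ j ∈ Jset (N + 3) (2 * c), Pprod (N + 3) (2 * c) j) = 2 ^ (2 * q - sdig q) := by
  have hc2 : c % 2 = 1 := Nat.odd_iff.1 hc
  obtain ⟨z, hz, hz0, hmain⟩ := padicNorm_Pprod_tuple hc (0 : Fin (N + 1) → ℕ) q r
  have hz0 := hz0 rfl
  have hunit : padicNorm 2 (genBinom z r) = 1 := by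
    obtain rfl | rfl | rfl : r = 0 ∨ r = 1 ∨ r = 2 := by omega
    · simp [genBinom_zero]
    · rw [genBinom_one, padicNorm_two_odd hz]
    · obtain ⟨p, rfl⟩ : ∃ p, q = 8 * p + 3 := ⟨q / 8, by omega⟩
      have hz1 : z = -(1 + 4 * p) := by push_cast at hz0; omega
      have : genBinom z 2 = (((1 + 4 * p) * (1 + 2 * p) : ℤ) : ℚ) := by
        rw [genBinom_two, hz1]
        push_cast
        ring
      rw [this]
      refine padicNorm_two_odd (Odd.mul ⟨2 * p, by ring⟩ ⟨p, by ring⟩)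
  rw [hunit, headExp_zero, zero_add, mul_one] at hmain
  refine padicNorm_sum_eq_of_dominant (i := tuple N 0 q r) ?_ (by positivity) hmain ?_
  · rw [mem_Jset_tuple, headWeight_zero]
    omega
  · intro j hj hne
    obtain ⟨a, x, y, rfl⟩ := exists_eq_tuple j
    rw [mem_Jset_tuple] at hj
    refine (padicNorm_Pprod_le hc a x y).trans_lt (pow_lt_pow_right₀ (by norm_num) ?_)
    have hs1 := sdig_le x
    have hs2 := sdig_add_le x 1
    have hs3 := sdig_add_le x 2
    obtain ⟨s1, s2, -⟩ := sdig_values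
    have hs4 := sdig_le q
    rcases exponent_bound hq hr hj with ⟨rfl, rfl, rfl⟩ | ⟨rfl, rfl, rfl⟩ | ⟨rfl, rfl, h3⟩ | h4 | h5
    · exact absurd rfl hne
    · rw [headExp_zero]
      omega
    · rw [headExp_single]
      omega
    · omega
    · omega

lemma sdig_of_mod_eight {q : ℕ} (hq : q % 8 = 7) :
    sdig (q - 1) + 1 = sdig q ∧ sdig (q - 2) + 1 = sdig q := by
  obtain ⟨k, rfl⟩ : ∃ k, q = 2 * (2 * k + 1) + 1 := ⟨q / 4, by omega⟩
  have h1 : 2 * (2 * k + 1) + 1 - 1 = 2 * (2 * k + 1) := by omega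
  have h2 : 2 * (2 * k + 1) + 1 - 2 = 2 * (2 * k) + 1 := by omega
  rw [h1, h2]
  rw [sdig_two_mul, sdig_two_mul_add_one (2 * k + 1), sdig_two_mul_add_one k,
    sdig_two_mul_add_one (2 * k), sdig_two_mul]
  exact ⟨rfl, rfl⟩

lemma padicNorm_sum_special {N c q : ℕ} (hc : Odd c) (hq : 2 * c + 1 = 3 * q + 2)
    (h8 : q % 8 = 7) :
    padicNorm 2 (∑ j ∈ Jset (N + 3) (2 * c), Pprod (N + 3) (2 * c) j) =
      2 ^ (2 * q - sdig q - 1) := by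
  obtain ⟨hs1, hs2⟩ := sdig_of_mod_eight h8
  have hs3 := sdig_le q
  obtain ⟨z, -, hz, hA⟩ := padicNorm_Pprod_tuple hc (0 : Fin (N + 1) → ℕ) q 2
  obtain ⟨w, -, hw, hB⟩ := padicNorm_Pprod_tuple hc (0 : Fin (N + 1) → ℕ) (q - 1) 5
  obtain ⟨v, hv, -, hC⟩ := padicNorm_Pprod_tuple hc (Pi.single (Fin.last N) 1) (q - 2) 1
  obtain ⟨p, hp⟩ : ∃ p, q + 1 = 8 * p := ⟨q / 8 + 1, by omega⟩
  have hz1 : z = 1 - 4 * p := by have := hz rfl; omega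
  have hw1 : w = 3 - 4 * p := by have := hw rfl; omega
  have hp0 : (p : ℚ) ≠ 0 := by
    have : p ≠ 0 := by omega
    exact_mod_cast this
  have hpp : 0 < padicNorm 2 (p : ℚ) :=
    lt_of_le_of_ne (padicNorm.nonneg _) (padicNorm.nonzero hp0).symm
  obtain ⟨E, hE⟩ : ∃ E, 2 * q - sdig q = E + 1 := ⟨2 * q - sdig q - 1, by omega⟩
  have hA' : padicNorm 2 (genBinom z 2) = 1 / 2 * padicNorm 2 (p : ℚ) := by
    have : genBinom z 2 = (((4 * p - 1 : ℤ)) : ℚ) * (2 * p) := by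
      rw [genBinom_two, hz1]; push_cast; ring
    rw [this, padicNorm.mul, padicNorm.mul, padicNorm_two_odd ⟨2 * p - 1, by ring⟩,
      padicNorm_two_two, one_mul]
  have hB' : padicNorm 2 (genBinom w 5) = padicNorm 2 (p : ℚ) := by
    have : genBinom w 5 =
        (((3 - 4 * p) * (1 - 2 * p) * (1 - 4 * p) * (1 + 4 * p) : ℤ) : ℚ) / (15 : ℤ) * p := by
      rw [genBinom_five, hw1]; push_cast; ring
    rw [this, padicNorm.mul, padicNorm.div, padicNorm_two_odd (z := 15) (by decide),
      padicNorm_two_odd, div_one, one_mul]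
    have h1 : Odd (3 - 4 * p : ℤ) := ⟨1 - 2 * p, by ring⟩
    have h2 : Odd (1 - 2 * p : ℤ) := ⟨-p, by ring⟩
    have h3 : Odd (1 - 4 * p : ℤ) := ⟨-2 * p, by ring⟩
    have h4 : Odd (1 + 4 * p : ℤ) := ⟨2 * p, by ring⟩
    exact ((h1.mul h2).mul h3).mul h4
  have hexpB : headExp N 0 + (2 * (q - 1) - sdig (q - 1)) = E := by rw [headExp_zero]; omega
  have hexpC : headExp N (Pi.single (Fin.last N) 1) + (2 * (q - 2) - sdig (q - 2)) = E := by
    rw [headExp_single]; omega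
  rw [headExp_zero, zero_add, hE, hA', pow_succ] at hA
  rw [hexpB, hB'] at hB
  rw [hexpC, genBinom_one, padicNorm_two_odd hv, mul_one] at hC
  have hne1 : tuple N 0 q 2 ≠ tuple N 0 (q - 1) 5 := fun h => by
    have := congrFun h (Fin.last _)
    simp [tuple] at this
  have hne2 : tuple N (Pi.single (Fin.last N) 1) (q - 2) 1 ≠ tuple N 0 q 2 := fun h => by
    have := congrFun h (Fin.last _)
    simp [tuple] at this
  have hne3 : tuple N (Pi.single (Fin.last N) 1) (q - 2) 1 ≠ tuple N 0 (q - 1) 5 := fun h => by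
    have := congrFun h (Fin.last _)
    simp [tuple] at this
  have hmA : tuple N 0 q 2 ∈ Jset (N + 3) (2 * c) := by
    rw [mem_Jset_tuple, headWeight_zero]; omega
  have hmB : tuple N 0 (q - 1) 5 ∈ (Jset (N + 3) (2 * c)).erase (tuple N 0 q 2) := by
    rw [mem_erase, mem_Jset_tuple, headWeight_zero]; exact ⟨hne1.symm, by omega⟩
  have hmC : tuple N (Pi.single (Fin.last N) 1) (q - 2) 1 ∈
      ((Jset (N + 3) (2 * c)).erase (tuple N 0 q 2)).erase (tuple N 0 (q - 1) 5) := by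
    rw [mem_erase, mem_erase, mem_Jset_tuple, headWeight_single]
    exact ⟨hne3, hne2, by omega⟩
  have hrest : padicNorm 2 (∑ j ∈ ((Jset (N + 3) (2 * c)).erase (tuple N 0 q 2)).erase
      (tuple N 0 (q - 1) 5), Pprod (N + 3) (2 * c) j) = 2 ^ E := by
    refine padicNorm_sum_eq_of_dominant hmC (by positivity) hC fun j hj hne => ?_
    obtain ⟨a, x, y, rfl⟩ := exists_eq_tuple j
    rw [mem_erase, mem_erase, mem_Jset_tuple] at hj
    obtain ⟨hj1, hj2, hj⟩ := hj
    refine (padicNorm_Pprod_le hc a x y).trans_lt (pow_lt_pow_right₀ (by norm_num) ?_)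
    rcases exponent_bound hq (by norm_num) hj with
      ⟨rfl, rfl, rfl⟩ | ⟨rfl, rfl, rfl⟩ | ⟨rfl, rfl, h3⟩ | h4 | h5
    · exact absurd rfl hj2
    · exact absurd rfl hj1
    · obtain rfl : y = 1 := by omega
      exact absurd rfl hne
    · omega
    · omega
  rw [← Finset.add_sum_erase _ _ hmA, ← Finset.add_sum_erase _ _ hmB, ← add_assoc, hE,
    Nat.add_sub_cancel]
  have hpE : (0 : ℚ) < 2 ^ E := by positivity
  have hAB : padicNorm 2 (Pprod (N + 3) (2 * c) (tuple N 0 q 2) +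
      Pprod (N + 3) (2 * c) (tuple N 0 (q - 1) 5)) < 2 ^ E := by
    have hle : padicNorm 2 (p : ℚ) ≤ 1 := padicNorm.of_nat p
    refine (padicNorm_two_add_lt (fun h0 => ?_) (by rw [hA, hB]; ring)).trans_le ?_
    · rw [h0, padicNorm.zero] at hA
      have : (0 : ℚ) < 2 ^ E * 2 * (1 / 2 * padicNorm 2 (p : ℚ)) := by positivity
      linarith
    · rw [hA]
      nlinarith
  rw [padicNorm.add_eq_max_of_ne (by rw [hrest]; exact hAB.ne), hrest, max_eq_right hAB.le]

/-- **Zagier's conjecture** (`m ≡ 2 mod 4`): with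
`b = -(1/m) ∑_{j ∈ J} ∏_k C_{j_k}(α_j(k))`, we have `b ≠ 0` and
`-ν(b) = ⌊(2/3)(m+1)⌋ - s(⌊(2/3)(m+1)⌋) + ε(m)`, where `ε(m) = 0` if
`m ≡ 22 mod 24` and `ε(m) = 1` otherwise. -/
theorem stmt0 (n m : ℕ) (hn : 3 ≤ n) (hm : 1 ≤ m) (hmn : m ≤ 2 ^ (n + 1) - 3)
    (h4 : m % 4 = 2)
    (b : ℚ) (hb : b = -(1 / (m : ℚ)) * ∑ j ∈ Jset n m, Pprod n m j) :
    b ≠ 0 ∧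
      -padicValRat 2 b =
        ((2 * (m + 1)) / 3 : ℕ) - (sdig ((2 * (m + 1)) / 3) : ℤ) +
          (if m % 24 = 22 then 0 else 1) := by
  obtain ⟨N, rfl⟩ : ∃ N, n = N + 3 := ⟨n - 3, by omega⟩
  obtain ⟨c, rfl⟩ : ∃ c, m = 2 * c := ⟨m / 2, by omega⟩
  have hc : Odd c := Nat.odd_iff.2 (by omega)
  have hfinal (E : ℕ) (h : padicNorm 2 (∑ j ∈ Jset (N + 3) (2 * c), Pprod (N + 3) (2 * c) j) =
      2 ^ E) : b ≠ 0 ∧ -padicValRat 2 b = E + 1 := by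
    have hbn : padicNorm 2 b = (2 : ℚ) ^ ((E : ℤ) + 1) := by
      have hc1 : padicNorm 2 (c : ℚ) = 1 := by
        exact_mod_cast padicNorm_two_odd (z := c) (by exact_mod_cast hc)
      rw [hb, padicNorm.mul, padicNorm.neg, h, padicNorm.div, padicNorm.one]
      push_cast
      rw [padicNorm.mul, padicNorm_two_two, hc1, zpow_add₀ two_ne_zero]
      simp [mul_comm]
    have hb0 : b ≠ 0 := by
      rintro rfl
      rw [padicNorm.zero] at hbn
      exact (zpow_pos (by norm_num : (0 : ℚ) < 2) _).ne hbn
    refine ⟨hb0, ?_⟩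
    rw [padicNorm.eq_zpow_of_nonzero hb0] at hbn
    exact zpow_right_injective₀ (by norm_num) (by norm_num) hbn
  obtain ⟨q, r, hr, hq⟩ : ∃ q r, r < 3 ∧ 2 * c + 1 = 3 * q + r :=
    ⟨(2 * c + 1) / 3, (2 * c + 1) % 3, by omega, by omega⟩
  have hs := sdig_le q
  by_cases h : r = 2 ∧ q % 8 = 7
  · obtain ⟨rfl, h8⟩ := h
    have hdiv : 2 * (2 * c + 1) / 3 = 2 * q + 1 := by omega
    obtain ⟨hb0, hv⟩ := hfinal _ (padicNorm_sum_special hc hq h8)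
    refine ⟨hb0, ?_⟩
    rw [hv, hdiv, sdig_two_mul_add_one, if_pos (by omega)]
    omega
  · obtain ⟨hb0, hv⟩ := hfinal _ (padicNorm_sum_generic hc hq hr h)
    refine ⟨hb0, ?_⟩
    rw [hv, if_neg (by omega)]
    obtain hr2 | rfl : r < 2 ∨ r = 2 := by omega
    · have hdiv : 2 * (2 * c + 1) / 3 = 2 * q := by omega
      rw [hdiv, sdig_two_mul]
      omega
    · have hdiv : 2 * (2 * c + 1) / 3 = 2 * q + 1 := by omega
      rw [hdiv, sdig_two_mul_add_one]
      omega
end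

section
/- Suppose m ≡ 2 (mod 4). Then the sum S = Σ_{j ∈ J} ∏_{k=1}^n C_{j_k}(α_j(k)) is nonzero, and −ν(S) = max { V(j) : j ∈ J, P(j) ≠ 0 }; equivalently, ν(S) equals the minimum of ν(P(j)) over those j ∈ J with P(j) ≠ 0. -/
open Finset

/-- `q / 2 ^ v` is a 2-integral rational whose residue modulo `2` is `t`. -/
def HasResidue (v : ℤ) (q : ℚ) (t : ZMod 2) : Prop :=
  ∃ a b : ℤ, Odd b ∧ q = 2 ^ v * (a / b) ∧ (a : ZMod 2) = t

namespace HasResidue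

variable {v w : ℤ} {p q : ℚ} {s t : ZMod 2}

lemma cast_ne_zero_of_odd {b : ℤ} (hb : Odd b) : (b : ℚ) ≠ 0 := by
  rintro h
  have : b = 0 := by exact_mod_cast h
  subst this
  simp at hb

lemma intCast_odd {a : ℤ} (ha : Odd a) : (a : ZMod 2) = 1 := by
  obtain ⟨k, rfl⟩ := ha
  have : (2 : ZMod 2) = 0 := rfl
  push_cast
  simp [this]

lemma odd_of_intCast {a : ℤ} (ha : (a : ZMod 2) = 1) : Odd a := by
  rw [← Int.not_even_iff_odd]
  rintro ⟨k, rfl⟩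
  push_cast at ha
  rw [CharTwo.add_self_eq_zero] at ha
  exact zero_ne_one ha

lemma ofInt (a : ℤ) : HasResidue 0 a a := ⟨a, 1, odd_one, by simp, rfl⟩

lemma zero : HasResidue v 0 0 := ⟨0, 1, odd_one, by simp, by simp⟩

lemma mul (hp : HasResidue v p s) (hq : HasResidue w q t) :
    HasResidue (v + w) (p * q) (s * t) := by
  obtain ⟨a, b, hb, rfl, rfl⟩ := hp
  obtain ⟨c, d, hd, rfl, rfl⟩ := hq
  refine ⟨a * c, b * d, hb.mul hd, ?_, by push_cast; rfl⟩
  rw [zpow_add₀ two_ne_zero]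
  push_cast
  rw [mul_div_mul_comm]
  ring

lemma add (hp : HasResidue v p s) (hq : HasResidue v q t) :
    HasResidue v (p + q) (s + t) := by
  obtain ⟨a, b, hb, rfl, rfl⟩ := hp
  obtain ⟨c, d, hd, rfl, rfl⟩ := hq
  refine ⟨a * d + b * c, b * d, hb.mul hd, ?_, ?_⟩
  · rw [← mul_add, div_add_div _ _ (cast_ne_zero_of_odd hb) (cast_ne_zero_of_odd hd)]
    push_cast
    rfl
  · push_cast
    rw [intCast_odd hb, intCast_odd hd]
    ring

lemma sum {ι : Type*} (J : Finset ι) {P : ι → ℚ} {T : ι → ZMod 2}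
    (h : ∀ j ∈ J, HasResidue v (P j) (T j)) :
    HasResidue v (∑ j ∈ J, P j) (∑ j ∈ J, T j) := by
  classical
  induction J using Finset.induction_on with
  | empty => simpa using zero
  | insert a J ha ih =>
    rw [Finset.sum_insert ha, Finset.sum_insert ha]
    exact (h a (Finset.mem_insert_self _ _)).add
      (ih fun j hj => h j (Finset.mem_insert_of_mem hj))

lemma prod {ι : Type*} (J : Finset ι) {P : ι → ℚ} {e : ι → ℤ}
    (h : ∀ j ∈ J, HasResidue (e j) (P j) 1) :
    HasResidue (∑ j ∈ J, e j) (∏ j ∈ J, P j) 1 := by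
  classical
  induction J using Finset.induction_on with
  | empty => simpa using ofInt 1
  | insert a J ha ih =>
    rw [Finset.sum_insert ha, Finset.prod_insert ha]
    simpa using (h a (Finset.mem_insert_self _ _)).mul
      (ih fun j hj => h j (Finset.mem_insert_of_mem hj))

lemma of_lt (hwv : w < v) (h : HasResidue v q t) : HasResidue w q 0 := by
  obtain ⟨a, b, hb, rfl, rfl⟩ := h
  obtain ⟨d, hd⟩ : ∃ d : ℕ, v = w + 1 + d := ⟨(v - w - 1).toNat, by omega⟩
  refine ⟨2 * 2 ^ d * a, b, hb, ?_, ?_⟩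
  · rw [hd, zpow_add₀ two_ne_zero, zpow_add₀ two_ne_zero]
    push_cast
    rw [zpow_natCast]
    ring
  · have : (2 : ZMod 2) = 0 := rfl
    push_cast
    simp [this]

lemma padicValRat_intCast_odd {a : ℤ} (ha : Odd a) : padicValRat 2 (a : ℚ) = 0 := by
  rw [padicValRat.of_int, padicValInt.eq_zero_of_not_dvd]
  · rfl
  · rw [← Int.not_even_iff_odd, even_iff_two_dvd] at ha
    exact_mod_cast ha

lemma le_padicValRat (h : HasResidue v q t) (hq : q ≠ 0) : v ≤ padicValRat 2 q := by
  obtain ⟨a, b, hb, rfl, rfl⟩ := h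
  have hb0 := cast_ne_zero_of_odd hb
  have ha0 : (a : ℚ) ≠ 0 := fun h => hq (by simp [h])
  rw [padicValRat.mul (by positivity) (div_ne_zero ha0 hb0), padicValRat.zpow,
    padicValRat.div ha0 hb0, padicValRat_intCast_odd hb, padicValRat.of_int]
  have := padicValRat.self (p := 2) one_lt_two
  push_cast at this
  rw [this]
  omega

lemma ne_zero (h : HasResidue v q 1) : q ≠ 0 := by
  obtain ⟨a, b, hb, rfl, ha⟩ := h
  exact mul_ne_zero (by positivity)
    (div_ne_zero (cast_ne_zero_of_odd (odd_of_intCast ha)) (cast_ne_zero_of_odd hb))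

lemma padicValRat_eq (h : HasResidue v q 1) : padicValRat 2 q = v := by
  obtain ⟨a, b, hb, rfl, ha⟩ := h
  have hb0 := cast_ne_zero_of_odd hb
  have ha := odd_of_intCast ha
  have ha0 := cast_ne_zero_of_odd ha
  rw [padicValRat.mul (by positivity) (div_ne_zero ha0 hb0), padicValRat.zpow,
    padicValRat.div ha0 hb0, padicValRat_intCast_odd hb, padicValRat_intCast_odd ha]
  have := padicValRat.self (p := 2) one_lt_two
  push_cast at this
  rw [this]
  omega

lemma inv_factorial (r : ℕ) :
    HasResidue (-(padicValNat 2 r.factorial : ℤ)) ((r.factorial : ℚ)⁻¹) 1 := by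
  obtain ⟨b, hb⟩ : 2 ^ padicValNat 2 r.factorial ∣ r.factorial := pow_padicValNat_dvd
  have hodd : Odd b := by
    rw [← Nat.not_even_iff_odd, even_iff_two_dvd]
    rintro ⟨c, rfl⟩
    refine pow_succ_padicValNat_not_dvd (p := 2) r.factorial_ne_zero ⟨c, ?_⟩
    rw [pow_succ, mul_assoc]
    exact hb
  refine ⟨1, b, by exact_mod_cast hodd, ?_, by simp⟩
  have hb' : (r.factorial : ℚ) = 2 ^ padicValNat 2 r.factorial * b := by exact_mod_cast hb
  rw [zpow_neg, zpow_natCast, hb', mul_inv]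
  simp

end HasResidue

/-- The exponent of `2` in the denominator of `C_j(a / 2 ^ r)` for odd `a` and `r ≥ 1`. -/
def binomExp (r j : ℕ) : ℕ := r * j + padicValNat 2 j.factorial

lemma hasResidue_genBinom {r : ℕ} (hr : r ≠ 0) {a : ℤ} (ha : Odd a) (j : ℕ) :
    HasResidue (-(binomExp r j : ℤ)) (genBinom (a / 2 ^ r) j) 1 := by
  have hterm : ∀ p ∈ Finset.range j, HasResidue (-(r : ℤ)) ((a : ℚ) / 2 ^ r - p) 1 := by
    intro p _
    refine ⟨a - 2 ^ r * p, 1, odd_one, ?_, HasResidue.intCast_odd ?_⟩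
    · rw [zpow_neg, zpow_natCast]
      push_cast
      field_simp
    · refine ha.sub_even (Even.mul_right ?_ _)
      exact (even_two).pow_of_ne_zero hr
  have := (HasResidue.prod _ hterm).mul (HasResidue.inv_factorial j)
  rw [genBinom, div_eq_mul_inv, binomExp]
  convert this using 1
  · simp
    ring
  · simp

lemma exists_int_eq_genBinom (a : ℤ) (r : ℕ) : ∃ c : ℤ, genBinom a r = c := by
  refine ⟨Ring.choose a r, ?_⟩
  have h := Ring.descPochhammer_eq_factorial_smul_choose a r
  rw [← Polynomial.eval_eq_smeval, descPochhammer_eval_eq_prod_range] at h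
  have h' : (∏ p ∈ Finset.range r, ((a : ℚ) - p)) = r.factorial * (Ring.choose a r : ℤ) := by
    have := congrArg (Int.cast : ℤ → ℚ) h
    push_cast at this
    simpa using this
  rw [genBinom, h', mul_div_cancel_left₀]
  exact_mod_cast r.factorial_ne_zero

lemma binomExp_one_add_le (a b : ℕ) :
    binomExp 1 a + binomExp 1 b ≤ binomExp 1 (a + b) := by
  have h := padicValNat_dvd_iff_le (p := 2)
    (n := padicValNat 2 (a.factorial * b.factorial)) (Nat.factorial_ne_zero (a + b))
  have := h.1 (pow_padicValNat_dvd.trans (Nat.factorial_mul_factorial_dvd_factorial_add a b))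
  rw [padicValNat.mul a.factorial_ne_zero b.factorial_ne_zero] at this
  unfold binomExp
  omega

lemma sum_binomExp_one_le {ι : Type*} (J : Finset ι) (a : ι → ℕ) :
    ∑ k ∈ J, binomExp 1 (a k) ≤ binomExp 1 (∑ k ∈ J, a k) := by
  classical
  induction J using Finset.induction_on with
  | empty => simp
  | insert x J hx ih =>
    rw [Finset.sum_insert hx, Finset.sum_insert hx]
    exact (Nat.add_le_add_left ih _).trans (binomExp_one_add_le _ _)

lemma binomExp_one_add_sub_le {a b : ℕ} (h : a ≤ b) :
    binomExp 1 a + (b - a) ≤ binomExp 1 b := by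
  have := binomExp_one_add_le a (b - a)
  rw [Nat.add_sub_cancel' h] at this
  have h2 : b - a ≤ binomExp 1 (b - a) := by unfold binomExp; omega
  omega

lemma padicValNat_factorial_two_pow_mul (k j : ℕ) :
    padicValNat 2 (2 ^ k * j).factorial = (2 ^ k - 1) * j + padicValNat 2 j.factorial := by
  induction k with
  | zero => simp
  | succ k ih =>
    rw [pow_succ', mul_assoc, padicValNat_factorial_mul, ih]
    obtain ⟨c, hc⟩ : ∃ c, 2 ^ k = c + 1 := ⟨2 ^ k - 1, by have := Nat.one_le_two_pow (n := k); omega⟩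
    rw [hc, show 2 * (c + 1) - 1 = 2 * c + 1 by omega, Nat.add_sub_cancel]
    ring

lemma binomExp_add_eq (k j : ℕ) :
    binomExp (k + 1) j + (2 ^ (k + 1) - (k + 2)) * j = binomExp 1 (2 ^ k * j) := by
  obtain ⟨c, hc⟩ : ∃ c, 2 ^ k = c + (k + 1) :=
    ⟨2 ^ k - (k + 1), by have := Nat.lt_two_pow_self (n := k); omega⟩
  unfold binomExp
  rw [padicValNat_factorial_two_pow_mul, pow_succ, hc,
    show (c + (k + 1)) * 2 - (k + 2) = 2 * c + k by omega,
    show c + (k + 1) - 1 = c + k by omega]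
  ring

lemma binomExp_one_succ (a : ℕ) :
    binomExp 1 (a + 1) = binomExp 1 a + 1 + padicValNat 2 (a + 1) := by
  unfold binomExp
  rw [Nat.factorial_succ, padicValNat.mul (by omega) a.factorial_ne_zero]
  ring

/-- The 2-adic order of the denominator of the product of all factors of `P(j)` but the last. -/
def denExp {N : ℕ} (j : Fin (N + 1) → ℕ) : ℕ :=
  ∑ k : Fin N, binomExp (k + 1) (j (Fin.rev k.succ))

lemma mem_Jset_iff {n m : ℕ} {j : Fin n → ℕ} :
    j ∈ Jset n m ↔ ∑ k : Fin n, (2 ^ ((k : ℕ) + 1) - 1) * j (Fin.rev k) = m + 1 := by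
  have hrev : ∑ k : Fin n, (2 ^ (n - (k : ℕ)) - 1) * j k =
      ∑ k : Fin n, (2 ^ ((k : ℕ) + 1) - 1) * j (Fin.rev k) := by
    rw [← Equiv.sum_comp Fin.revPerm]
    refine Finset.sum_congr rfl fun k _ => ?_
    rw [Fin.revPerm_apply, Fin.val_rev, show n - (n - ((k : ℕ) + 1)) = k + 1 by omega]
  rw [Jset, Finset.mem_filter, hrev, and_iff_right_iff_imp, ← hrev]
  intro h
  rw [Fintype.mem_piFinset]
  intro k
  have h1 := Finset.single_le_sum
    (f := fun k : Fin n => (2 ^ (n - (k : ℕ)) - 1) * j k) (fun _ _ => Nat.zero_le _)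
    (Finset.mem_univ k)
  have h2 : 2 ≤ 2 ^ (n - (k : ℕ)) := by
    simpa using Nat.pow_le_pow_right two_pos (show 1 ≤ n - (k : ℕ) by omega)
  have h3 := Nat.le_mul_of_pos_left (j k) (show 0 < 2 ^ (n - (k : ℕ)) - 1 by omega)
  rw [Finset.mem_range]
  omega

lemma inJ_iff_mem {n m : ℕ} {j : Fin n → ℕ} : inJ n m j ↔ j ∈ Jset n m := by
  rw [mem_Jset_iff, inJ, ← Equiv.sum_comp Fin.revPerm]
  refine Eq.congr (Finset.sum_congr rfl fun k _ => ?_) rfl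
  rw [Fin.revPerm_apply, Fin.val_rev, show n - (n - ((k : ℕ) + 1)) = k + 1 by omega]

lemma alphaF_rev (n m : ℕ) (j : Fin n → ℕ) (k : Fin n) :
    alphaF n m j (Fin.rev k) = (m : ℚ) / 2 ^ ((k : ℕ) + 1) -
      ∑ I : Fin n, if (k : ℕ) < I then 2 ^ ((I : ℕ) - k) * (j (Fin.rev I) : ℚ) else 0 := by
  rw [alphaF, Fin.val_rev, show n - (n - ((k : ℕ) + 1)) = k + 1 by omega,
    ← Equiv.sum_comp Fin.revPerm]
  congr 1
  refine Finset.sum_congr rfl fun I _ => ?_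
  rw [Fin.revPerm_apply, Fin.val_rev]
  have hk := k.2
  have hI := I.2
  by_cases h : (k : ℕ) < I
  · rw [if_pos h, if_pos (by omega)]
    congr 2
    omega
  · rw [if_neg h, if_neg (by omega)]

lemma alphaF_rev_zero {N u : ℕ} (j : Fin (N + 1) → ℕ) :
    alphaF (N + 1) (2 * u) j (Fin.rev 0) =
      u - ∑ k : Fin N, 2 ^ ((k : ℕ) + 1) * (j (Fin.rev k.succ) : ℚ) := by
  rw [alphaF_rev, Fin.sum_univ_succ, Fin.val_zero]
  simp only [Fin.val_succ, lt_irrefl, Nat.succ_pos, if_true, if_false, Nat.sub_zero, zero_add,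
    pow_one]
  push_cast
  rw [mul_div_cancel_left₀ _ two_ne_zero]

lemma alphaF_rev_zero_of_mem {N u : ℕ} {j : Fin (N + 1) → ℕ} (hj : j ∈ Jset (N + 1) (2 * u)) :
    alphaF (N + 1) (2 * u) j (Fin.rev 0) =
      ((j (Fin.rev 0) : ℚ) - 1 - ∑ k : Fin N, (j (Fin.rev k.succ) : ℚ)) / 2 := by
  rw [mem_Jset_iff, Fin.sum_univ_succ] at hj
  have h : ((j (Fin.rev 0) : ℚ) + ∑ k : Fin N, (2 ^ ((k : ℕ) + 2) - 1) * (j (Fin.rev k.succ) : ℚ))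
      = 2 * u + 1 := by
    have := congrArg (Nat.cast : ℕ → ℚ) hj
    push_cast [Nat.cast_sub Nat.one_le_two_pow, Fin.val_succ, Fin.val_zero] at this
    rw [← this]
    norm_num [add_assoc]
  simp only [sub_mul, one_mul, Finset.sum_sub_distrib, pow_succ _ (_ + 1), mul_right_comm _ (2 : ℚ),
    ← Finset.sum_mul] at h
  rw [alphaF_rev_zero]
  linarith

lemma exists_alphaF_rev_succ {N u : ℕ} (hu : Odd u) (j : Fin (N + 1) → ℕ) (k : Fin N) :
    ∃ a : ℤ, Odd a ∧
      alphaF (N + 1) (2 * u) j (Fin.rev k.succ) = (a : ℚ) / 2 ^ ((k : ℕ) + 1) := by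
  refine ⟨u - 2 ^ ((k : ℕ) + 1) * ∑ I : Fin (N + 1),
    if ((k.succ : Fin (N + 1)) : ℕ) < I then
      2 ^ ((I : ℕ) - (k.succ : Fin (N + 1))) * (j (Fin.rev I) : ℤ) else 0, ?_, ?_⟩
  · refine Odd.sub_even (by exact_mod_cast hu) (Even.mul_right ?_ _)
    exact even_two.pow_of_ne_zero (by omega)
  · rw [alphaF_rev]
    push_cast
    rw [sub_div, mul_div_cancel_left₀ _ (by positivity), Fin.val_succ, pow_succ _ (_ + 1)]
    congr 1
    field_simp

lemma exists_Pprod_eq {N u : ℕ} (hu : Odd u) (j : Fin (N + 1) → ℕ) :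
    ∃ R : ℚ, HasResidue (-(denExp j : ℤ)) R 1 ∧ Pprod (N + 1) (2 * u) j =
      genBinom (alphaF (N + 1) (2 * u) j (Fin.rev 0)) (j (Fin.rev 0)) * R := by
  refine ⟨∏ k : Fin N, genBinom (alphaF (N + 1) (2 * u) j (Fin.rev k.succ)) (j (Fin.rev k.succ)),
    ?_, ?_⟩
  · rw [denExp, Nat.cast_sum, ← Finset.sum_neg_distrib]
    refine HasResidue.prod _ fun k _ => ?_
    obtain ⟨a, ha, h⟩ := exists_alphaF_rev_succ hu j k
    rw [h]
    exact hasResidue_genBinom (by omega) ha _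
  · rw [Pprod, ← Equiv.prod_comp Fin.revPerm, Fin.prod_univ_succ]
    rfl

lemma hasResidue_Pprod {N u : ℕ} (hu : Odd u) {j : Fin (N + 1) → ℕ} {w : ℤ} {t : ZMod 2}
    (h : HasResidue w (genBinom (alphaF (N + 1) (2 * u) j (Fin.rev 0)) (j (Fin.rev 0))) t) :
    HasResidue (w - denExp j) (Pprod (N + 1) (2 * u) j) t := by
  obtain ⟨R, hR, hP⟩ := exists_Pprod_eq hu j
  rw [hP, sub_eq_add_neg]
  simpa using h.mul hR

lemma hasResidue_Pprod_of_denExp_lt {N u : ℕ} (hu : Odd u) {j : Fin (N + 1) → ℕ} {w : ℕ}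
    (h : denExp j < w) : HasResidue (-(w : ℤ)) (Pprod (N + 1) (2 * u) j) 0 := by
  have hint : ∃ a : ℤ, alphaF (N + 1) (2 * u) j (Fin.rev 0) = a :=
    ⟨u - ∑ k : Fin N, 2 ^ ((k : ℕ) + 1) * (j (Fin.rev k.succ) : ℤ), by
      rw [alphaF_rev_zero]; push_cast; rfl⟩
  obtain ⟨a, ha⟩ := hint
  obtain ⟨c, hc⟩ := exists_int_eq_genBinom a (j (Fin.rev 0))
  refine (hasResidue_Pprod hu (w := 0) (t := c) ?_).of_lt (by omega)
  rw [ha, hc]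
  exact HasResidue.ofInt c

/-- The tuple whose last three entries are `z, y, x` and whose other entries vanish. -/
def tailTuple (N z y x : ℕ) : Fin (N + 3) → ℕ := fun k =>
  (Fin.cons x (Fin.cons y (Fin.cons z fun _ => 0)) : Fin (N + 3) → ℕ) (Fin.rev k)

section tailTuple

variable {N : ℕ} (z y x : ℕ)

lemma tailTuple_zero : tailTuple N z y x (Fin.rev 0) = x := by simp [tailTuple]

lemma tailTuple_one : tailTuple N z y x (Fin.rev (Fin.succ 0)) = y := by
  rw [tailTuple, Fin.rev_rev, Fin.cons_succ, Fin.cons_zero]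

lemma tailTuple_two : tailTuple N z y x (Fin.rev (Fin.succ (Fin.succ 0))) = z := by
  rw [tailTuple, Fin.rev_rev, Fin.cons_succ, Fin.cons_succ, Fin.cons_zero]

lemma tailTuple_succ (k : Fin N) :
    tailTuple N z y x (Fin.rev k.succ.succ.succ) = 0 := by
  rw [tailTuple, Fin.rev_rev, Fin.cons_succ, Fin.cons_succ, Fin.cons_succ]

lemma denExp_tailTuple : denExp (tailTuple N z y x) = binomExp 1 y + binomExp 2 z := by
  rw [denExp, Fin.sum_univ_succ, Fin.sum_univ_succ]
  simp only [tailTuple_one, tailTuple_two, tailTuple_succ]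
  simp [binomExp]

lemma tailTuple_mem_Jset {m : ℕ} (h : 7 * z + 3 * y + x = m + 1) :
    tailTuple N z y x ∈ Jset (N + 3) m := by
  rw [mem_Jset_iff, Fin.sum_univ_succ, Fin.sum_univ_succ, Fin.sum_univ_succ]
  simp only [tailTuple_zero, tailTuple_one, tailTuple_two, tailTuple_succ, Fin.val_succ,
    Fin.val_zero, mul_zero, Finset.sum_const_zero]
  omega

lemma alphaF_tailTuple {u : ℕ} (h : 7 * z + 3 * y + x = 2 * u + 1) :
    alphaF (N + 3) (2 * u) (tailTuple N z y x) (Fin.rev 0) = ((x : ℚ) - 1 - (y + z)) / 2 := by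
  rw [alphaF_rev_zero_of_mem (tailTuple_mem_Jset z y x h), Fin.sum_univ_succ, Fin.sum_univ_succ]
  simp only [tailTuple_zero, tailTuple_one, tailTuple_two, tailTuple_succ]
  simp

lemma hasResidue_tailTuple {u : ℕ} (hu : Odd u) (h : 7 * z + 3 * y + x = 2 * u + 1)
    {w : ℤ} {t : ZMod 2} (hw : HasResidue w (genBinom (((x : ℚ) - 1 - (y + z)) / 2) x) t) :
    HasResidue (w - (binomExp 1 y + binomExp 2 z : ℕ))
      (Pprod (N + 3) (2 * u) (tailTuple N z y x)) t := by
  rw [← denExp_tailTuple (N := N) z y x]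
  refine hasResidue_Pprod hu ?_
  rw [alphaF_tailTuple z y x h, tailTuple_zero]
  exact hw

variable {z y x}

lemma eq_tailTuple {j : Fin (N + 3) → ℕ} (h0 : j (Fin.rev 0) = x)
    (h1 : j (Fin.rev (Fin.succ 0)) = y) (h2 : j (Fin.rev (Fin.succ (Fin.succ 0))) = z)
    (h3 : ∀ k : Fin N, j (Fin.rev k.succ.succ.succ) = 0) : j = tailTuple N z y x := by
  funext k
  rw [← Fin.rev_rev k]
  generalize Fin.rev k = k
  refine Fin.cases ?_ (fun k => Fin.cases ?_ (fun k => Fin.cases ?_ (fun k => ?_) k) k) k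
  · rw [h0, tailTuple_zero]
  · rw [h1, tailTuple_one]
  · rw [h2, tailTuple_two]
  · rw [h3, tailTuple_succ]

end tailTuple

/-- Write `i_k` for the entry of `j` of weight `2^(k+1) - 1`. With `K = ∑ 2^(k-1) i_k` and
`D = ∑ (2^k - k - 1) i_k` over `k ≥ 1`, one has `3 K ≤ m + 1` and `denExp j + D ≤ binomExp 1 K`;
here `K = y + 2 z + s` and `D ≥ z + 4 r`, where `r` is the sum of the `i_k` with `k ≥ 3`. -/
lemma exists_denExp_bound {N m : ℕ} {j : Fin (N + 3) → ℕ} (hj : j ∈ Jset (N + 3) m) :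
    ∃ z y x r s d : ℕ, denExp j + (z + 4 * r) ≤ binomExp 1 (y + 2 * z + s) ∧
      3 * (y + 2 * z + s) + (z + d) + x = m + 1 ∧
      (r = 0 → s = 0 ∧ d = 0 ∧ j = tailTuple N z y x) := by
  refine ⟨j (Fin.rev (Fin.succ (Fin.succ 0))), j (Fin.rev (Fin.succ 0)), j (Fin.rev 0),
    ∑ k : Fin N, j (Fin.rev k.succ.succ.succ),
    ∑ k : Fin N, 2 ^ ((k : ℕ) + 2) * j (Fin.rev k.succ.succ.succ),
    ∑ k : Fin N, (2 ^ ((k : ℕ) + 2) - 1) * j (Fin.rev k.succ.succ.succ), ?_, ?_, ?_⟩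
  · have h1 := sum_binomExp_one_le Finset.univ
      fun k : Fin (N + 2) => 2 ^ (k : ℕ) * j (Fin.rev k.succ)
    simp only [← binomExp_add_eq, Finset.sum_add_distrib] at h1
    have h2 : 4 * ∑ k : Fin N, j (Fin.rev k.succ.succ.succ) ≤
        ∑ k : Fin N, (2 ^ ((k : ℕ) + 3) - ((k : ℕ) + 4)) * j (Fin.rev k.succ.succ.succ) := by
      rw [Finset.mul_sum]
      refine Finset.sum_le_sum fun k _ => Nat.mul_le_mul_right _ ?_
      have := Nat.lt_two_pow_self (n := k)
      rw [pow_add]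
      omega
    rw [← denExp, Fin.sum_univ_succ (fun k : Fin (N + 2) => (_ - _) * _),
      Fin.sum_univ_succ (n := N), Fin.sum_univ_succ (fun k : Fin (N + 2) => 2 ^ (k : ℕ) * _),
      Fin.sum_univ_succ (n := N)] at h1
    simp only [Fin.val_succ, Fin.val_zero, add_assoc, Nat.reduceAdd, zero_add, pow_zero, pow_one,
      one_mul, Nat.reducePow, Nat.reduceSub, zero_mul] at h1
    simp only [add_assoc]
    omega
  · rw [mem_Jset_iff, Fin.sum_univ_succ, Fin.sum_univ_succ, Fin.sum_univ_succ] at hj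
    have h2 : ∑ k : Fin N, (2 ^ ((k : ℕ) + 4) - 1) * j (Fin.rev k.succ.succ.succ) =
        3 * ∑ k : Fin N, 2 ^ ((k : ℕ) + 2) * j (Fin.rev k.succ.succ.succ) +
        ∑ k : Fin N, (2 ^ ((k : ℕ) + 2) - 1) * j (Fin.rev k.succ.succ.succ) := by
      rw [Finset.mul_sum, ← Finset.sum_add_distrib]
      refine Finset.sum_congr rfl fun k _ => ?_
      rw [← mul_assoc, ← add_mul]
      congr 1
      have := Nat.one_le_two_pow (n := (k : ℕ) + 2)
      rw [show (k : ℕ) + 4 = k + 2 + 2 by ring, pow_add]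
      omega
    simp only [Fin.val_succ, Fin.val_zero] at hj
    simp only [add_assoc, Nat.reduceAdd] at hj
    rw [h2] at hj
    norm_num at hj ⊢
    omega
  · intro h
    have h3 : ∀ k : Fin N, j (Fin.rev k.succ.succ.succ) = 0 := by
      simpa only [Finset.sum_eq_zero_iff, Finset.mem_univ, true_imp_iff] using h
    exact ⟨by simp only [h3, mul_zero, Finset.sum_const_zero],
      by simp only [h3, mul_zero, Finset.sum_const_zero],
      eq_tailTuple rfl rfl rfl h3⟩

lemma isGreatest_of_hasResidue {n m : ℕ} {w : ℤ} {t : (Fin n → ℕ) → ZMod 2}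
    (h : ∀ j ∈ Jset n m, HasResidue w (Pprod n m j) (t j)) (ht : ∑ j ∈ Jset n m, t j = 1) :
    (∑ j ∈ Jset n m, Pprod n m j) ≠ 0 ∧
      IsGreatest {t : ℤ | ∃ j : Fin n → ℕ, inJ n m j ∧ Pprod n m j ≠ 0 ∧ t = V n m j}
        (-padicValRat 2 (∑ j ∈ Jset n m, Pprod n m j)) := by
  have hS := HasResidue.sum _ h
  rw [ht] at hS
  refine ⟨hS.ne_zero, ?_, ?_⟩
  · obtain ⟨j, hj, hne⟩ := Finset.exists_ne_zero_of_sum_ne_zero (ht ▸ one_ne_zero)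
    have hr := h j hj
    rw [Fin.eq_one_of_ne_zero (t j) hne] at hr
    refine ⟨j, inJ_iff_mem.2 hj, hr.ne_zero, ?_⟩
    rw [V, hr.padicValRat_eq, hS.padicValRat_eq]
  · rintro _ ⟨j, hj, hne, rfl⟩
    rw [V, hS.padicValRat_eq]
    exact neg_le_neg ((h j (inJ_iff_mem.1 hj)).le_padicValRat hne)

lemma exists_residues_of_unique_max {N u y x : ℕ} (hu : Odd u) (hx : x < 3)
    (h : 3 * y + x = 2 * u + 1)
    (hC : HasResidue 0 (genBinom (((x : ℚ) - 1 - y) / 2) x) 1) :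
    ∃ (w : ℤ) (t : (Fin (N + 3) → ℕ) → ZMod 2),
      (∀ j ∈ Jset (N + 3) (2 * u), HasResidue w (Pprod (N + 3) (2 * u) j) (t j)) ∧
      ∑ j ∈ Jset (N + 3) (2 * u), t j = 1 := by
  refine ⟨-(binomExp 1 y : ℤ), fun j => if j = tailTuple N 0 y x then 1 else 0, ?_, ?_⟩
  · intro j hj
    beta_reduce
    split_ifs with hjA
    · subst hjA
      have h0 : binomExp 2 0 = 0 := by simp [binomExp]
      simpa only [h0, add_zero, zero_sub] using
        hasResidue_tailTuple (N := N) 0 y x hu (by omega) (w := 0) (by simpa using hC)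
    · refine hasResidue_Pprod_of_denExp_lt hu ?_
      obtain ⟨z, y', x', r, s, d, h1, h2, h3⟩ := exists_denExp_bound hj
      have h4 := binomExp_one_add_sub_le (show y' + 2 * z + s ≤ y by omega)
      by_contra hlt
      obtain ⟨rfl, rfl, h5⟩ := h3 (by omega)
      obtain rfl : z = 0 := by omega
      obtain rfl : y' = y := by omega
      obtain rfl : x' = x := by omega
      exact hjA h5
  · rw [Finset.sum_ite_eq', if_pos (tailTuple_mem_Jset _ _ _ (by omega))]

lemma exists_residues_of_three_candidates {N u q : ℕ} (hu : Odd u)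
    (h : 3 * (8 * q + 7) + 2 = 2 * u + 1) :
    ∃ (w : ℤ) (t : (Fin (N + 3) → ℕ) → ZMod 2),
      (∀ j ∈ Jset (N + 3) (2 * u), HasResidue w (Pprod (N + 3) (2 * u) j) (t j)) ∧
      ∑ j ∈ Jset (N + 3) (2 * u), t j = 1 := by
  have hv : padicValNat 2 (8 * q + 7) = 0 :=
    padicValNat.eq_zero_of_not_dvd (by omega)
  have hv' : padicValNat 2 (8 * q + 6) = 1 := by
    rw [show 8 * q + 6 = 2 * (4 * q + 3) by ring, padicValNat.mul two_ne_zero (by omega),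
      padicValNat.self one_lt_two, padicValNat.eq_zero_of_not_dvd (n := 4 * q + 3) (by omega)]
  have e7 : binomExp 1 (8 * q + 7) = _ := binomExp_one_succ (8 * q + 6)
  have e6 : binomExp 1 (8 * q + 6) = _ := binomExp_one_succ (8 * q + 5)
  rw [show 8 * q + 6 + 1 = 8 * q + 7 by ring, hv] at e7
  rw [show 8 * q + 5 + 1 = 8 * q + 6 by ring, hv'] at e6
  have e2 : binomExp 2 1 = 2 := by simp [binomExp]
  have e0 : binomExp 2 0 = 0 := by simp [binomExp]
  have two : (2 : ZMod 2) = 0 := rfl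
  refine ⟨-(binomExp 1 (8 * q + 6) : ℤ), fun j =>
    (if j = tailTuple N 1 (8 * q + 5) 1 then 1 else 0) +
    ((if j = tailTuple N 0 (8 * q + 7) 2 then (q + 1 : ZMod 2) else 0) +
    (if j = tailTuple N 0 (8 * q + 6) 5 then (q + 1 : ZMod 2) else 0)), ?_, ?_⟩
  · intro j hj
    beta_reduce
    have hne {z y x z' y' x' : ℕ} (hx : x ≠ x') : tailTuple N z y x ≠ tailTuple N z' y' x' :=
      fun h => hx (by
        rw [← tailTuple_zero (N := N) z y x, h, tailTuple_zero])
    by_cases hjC : j = tailTuple N 1 (8 * q + 5) 1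
    · subst hjC
      rw [if_pos rfl, if_neg (hne (by omega)), if_neg (hne (by omega)), add_zero, add_zero]
      convert hasResidue_tailTuple (N := N) 1 (8 * q + 5) 1 hu (by omega) (w := 0) (t := 1)
        ?_ using 1
      · omega
      · convert HasResidue.ofInt (-(4 * q + 3)) using 1
        · simp [genBinom]
          ring
        · exact (HasResidue.intCast_odd ⟨-(2 * q + 2), by ring⟩).symm
    by_cases hjA : j = tailTuple N 0 (8 * q + 7) 2
    · subst hjA
      rw [if_neg (hne (by omega)), if_pos rfl, if_neg (hne (by omega)), add_zero, zero_add]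
      convert hasResidue_tailTuple (N := N) 0 (8 * q + 7) 2 hu (by omega) (w := 1) (t := q + 1)
        ?_ using 1
      · omega
      · refine ⟨(4 * q + 3) * (q + 1), 1, odd_one, ?_, ?_⟩
        · simp [genBinom, Finset.prod_range_succ]
          ring
        · push_cast
          linear_combination (2 * q + 1) * (q + 1 : ZMod 2) * two
    by_cases hjB : j = tailTuple N 0 (8 * q + 6) 5
    · subst hjB
      rw [if_neg (hne (by omega)), if_neg (hne (by omega)), if_pos rfl, zero_add, zero_add]
      convert hasResidue_tailTuple (N := N) 0 (8 * q + 6) 5 hu (by omega) (w := 0) (t := q + 1)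
        ?_ using 1
      · omega
      · refine ⟨-((4 * q + 1) * (2 * q + 1) * (4 * q + 3) * (4 * q + 5) * (q + 1)), 15,
          by decide, ?_, ?_⟩
        · simp [genBinom, Finset.prod_range_succ, Nat.factorial]
          ring
        · have (a : ℤ) (ha : Odd a) : ((a * (q + 1) : ℤ) : ZMod 2) = q + 1 := by
            push_cast
            rw [HasResidue.intCast_odd ha, one_mul]
          rw [← neg_mul]
          refine this _ (Odd.neg ?_)
          refine Odd.mul (Odd.mul (Odd.mul ?_ ?_) ?_) ?_
          · exact ⟨2 * q, by ring⟩
          · exact ⟨q, by ring⟩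
          · exact ⟨2 * q + 1, by ring⟩
          · exact ⟨2 * q + 2, by ring⟩
    rw [if_neg hjC, if_neg hjA, if_neg hjB, add_zero, add_zero]
    refine hasResidue_Pprod_of_denExp_lt hu ?_
    obtain ⟨z, y', x', r, s, d, h1, h2, h3⟩ := exists_denExp_bound hj
    have h4 := binomExp_one_add_sub_le (show y' + 2 * z + s ≤ 8 * q + 7 by omega)
    by_contra hlt
    obtain ⟨rfl, rfl, h5⟩ := h3 (by omega)
    obtain rfl | rfl : z = 0 ∨ z = 1 := by omega
    · obtain rfl | rfl : y' = 8 * q + 7 ∨ y' = 8 * q + 6 := by omega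
      · obtain rfl : x' = 2 := by omega
        exact hjA h5
      · obtain rfl : x' = 5 := by omega
        exact hjB h5
    · obtain rfl : y' = 8 * q + 5 := by omega
      obtain rfl : x' = 1 := by omega
      exact hjC h5
  · rw [Finset.sum_add_distrib, Finset.sum_add_distrib, Finset.sum_ite_eq', Finset.sum_ite_eq',
      Finset.sum_ite_eq', if_pos (tailTuple_mem_Jset _ _ _ (by omega)),
      if_pos (tailTuple_mem_Jset _ _ _ (by omega)), if_pos (tailTuple_mem_Jset _ _ _ (by omega)),
      CharTwo.add_self_eq_zero, add_zero]

lemma exists_residues {N u : ℕ} (hu : Odd u) :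
    ∃ (w : ℤ) (t : (Fin (N + 3) → ℕ) → ZMod 2),
      (∀ j ∈ Jset (N + 3) (2 * u), HasResidue w (Pprod (N + 3) (2 * u) j) (t j)) ∧
      ∑ j ∈ Jset (N + 3) (2 * u), t j = 1 := by
  obtain ⟨k, hk⟩ := hu
  have hu : Odd u := ⟨k, hk⟩
  obtain ⟨y, hy | hy | hy⟩ : ∃ y, 2 * u + 1 = 3 * y + 0 ∨ 2 * u + 1 = 3 * y + 1 ∨
      2 * u + 1 = 3 * y + 2 := ⟨(2 * u + 1) / 3, by omega⟩
  · refine exists_residues_of_unique_max hu (by omega) hy.symm ?_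
    simpa [genBinom] using HasResidue.ofInt 1
  · refine exists_residues_of_unique_max hu (by omega) hy.symm ?_
    obtain ⟨c, rfl⟩ : ∃ c, y = 4 * c + 2 := ⟨y / 4, by omega⟩
    convert HasResidue.ofInt (-(2 * c + 1)) using 1
    · simp [genBinom]
      ring
    · exact (HasResidue.intCast_odd ⟨-(c + 1), by ring⟩).symm
  · obtain ⟨q, rfl | rfl⟩ : ∃ q, y = 8 * q + 3 ∨ y = 8 * q + 7 := ⟨y / 8, by omega⟩
    · refine exists_residues_of_unique_max hu (by omega) hy.symm ?_
      convert HasResidue.ofInt ((4 * q + 1) * (2 * q + 1)) using 1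
      · simp [genBinom, Finset.prod_range_succ]
        ring
      · refine (HasResidue.intCast_odd (Odd.mul ⟨2 * q, by ring⟩ ⟨q, by ring⟩)).symm
    · exact exists_residues_of_three_candidates hu hy.symm

/-- For `m ≡ 2 mod 4`, the sum `S = ∑_{j ∈ J} P(j)` is nonzero and `-ν(S)`
is the maximum of `V(j)` over `j ∈ J` with `P(j) ≠ 0`. -/
theorem stmt1 (n m : ℕ) (hn : 3 ≤ n) (hm : 1 ≤ m) (hmn : m ≤ 2 ^ (n + 1) - 3)
    (h4 : m % 4 = 2) :
    (∑ j ∈ Jset n m, Pprod n m j) ≠ 0 ∧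
      IsGreatest {t : ℤ | ∃ j : Fin n → ℕ, inJ n m j ∧ Pprod n m j ≠ 0 ∧ t = V n m j}
        (-padicValRat 2 (∑ j ∈ Jset n m, Pprod n m j)) := by
  obtain ⟨N, rfl⟩ : ∃ N, n = N + 3 := ⟨n - 3, by omega⟩
  obtain ⟨u, rfl, hu⟩ : ∃ u, m = 2 * u ∧ Odd u :=
    ⟨m / 2, by omega, Nat.odd_iff.2 (by omega)⟩
  obtain ⟨w, t, h, ht⟩ := exists_residues (N := N) hu
  exact isGreatest_of_hasResidue h ht
end

section
/- Suppose m ≡ 2 (mod 4) and m + 1 ≡ 1 (mod 3). Let j* be the n-tuple with j*_(n−1) = m/3, j*_n = 1, and all other entries 0. Then j* ∈ J, P(j*) ≠ 0, and for every j ∈ J with j ≠ j*, either P(j) = 0 or V(j) < V(j*). -/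
open Finset

/-- Along a finite sum, the alternative `a = b = 0` or `a + 3 ≤ b` is inherited from the terms. -/
lemma sum_eq_zero_or_sum_add_three_le {ι : Type*} (s : Finset ι) (a b : ι → ℕ)
    (h : ∀ k ∈ s, (a k = 0 ∧ b k = 0) ∨ a k + 3 ≤ b k) :
    (∑ k ∈ s, a k = 0 ∧ ∑ k ∈ s, b k = 0) ∨ ∑ k ∈ s, a k + 3 ≤ ∑ k ∈ s, b k := by
  classical
  induction s using Finset.induction_on with
  | empty => simp
  | insert x s hx ih =>
    rw [Finset.sum_insert hx, Finset.sum_insert hx]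
    have h1 := h x (Finset.mem_insert_self x s)
    have h2 := ih fun k hk => h k (Finset.mem_insert_of_mem hk)
    omega

lemma le_two_mul_padicValNat_two_factorial_add_one (N : ℕ) :
    N ≤ 2 * padicValNat 2 N.factorial + 1 := by
  have h : padicValNat 2 (2 * (N / 2)).factorial =
      padicValNat 2 (N / 2).factorial + N / 2 := padicValNat_factorial_mul (p := 2) (N / 2)
  have h2 : padicValNat 2 (2 * (N / 2)).factorial ≤ padicValNat 2 N.factorial :=
    (padicValNat_dvd_iff_le (Nat.factorial_ne_zero N)).1
      (pow_padicValNat_dvd.trans (Nat.factorial_dvd_factorial (Nat.mul_div_le N 2)))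
  omega

lemma padicValNat_two_factorial_add_le (a b : ℕ) :
    padicValNat 2 a.factorial + padicValNat 2 b.factorial ≤ padicValNat 2 (a + b).factorial := by
  rw [← padicValNat.mul (Nat.factorial_ne_zero a) (Nat.factorial_ne_zero b)]
  exact (padicValNat_dvd_iff_le (Nat.factorial_ne_zero _)).1
    (pow_padicValNat_dvd.trans (Nat.factorial_mul_factorial_dvd_factorial_add a b))

lemma padicValRat_prod {ι : Type*} (p : ℕ) [Fact p.Prime] (s : Finset ι) (f : ι → ℚ)
    (h : ∀ k ∈ s, f k ≠ 0) : padicValRat p (∏ k ∈ s, f k) = ∑ k ∈ s, padicValRat p (f k) := by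
  classical
  induction s using Finset.induction_on with
  | empty => simp
  | insert x s hx ih =>
    have hs : ∀ k ∈ s, f k ≠ 0 := fun k hk => h k (Finset.mem_insert_of_mem hk)
    rw [Finset.prod_insert hx, Finset.sum_insert hx,
      padicValRat.mul (h x (Finset.mem_insert_self x s)) (Finset.prod_ne_zero_iff.2 hs), ih hs]

lemma padicValRat_two_odd_div {o : ℤ} (ho : Odd o) (e : ℕ) :
    padicValRat 2 ((o : ℚ) / 2 ^ e) = -(e : ℤ) := by
  have h0 : (o : ℚ) ≠ 0 := by
    have : o ≠ 0 := by rintro rfl; simp at ho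
    exact_mod_cast this
  have h2 : ¬ (2 : ℤ) ∣ o := by rwa [← even_iff_two_dvd, Int.not_even_iff_odd]
  have h3 : padicValInt 2 o = 0 := padicValInt.eq_zero_of_not_dvd (by exact_mod_cast h2)
  have h4 : padicValRat 2 (2 : ℚ) = 1 := by exact_mod_cast padicValRat.self (p := 2) one_lt_two
  rw [padicValRat.div h0 (by positivity), padicValRat.pow, padicValRat.of_int, h3, h4]
  simp

lemma padicValRat_genBinom_odd_div {o : ℤ} (ho : Odd o) {e : ℕ} (he : e ≠ 0) (r : ℕ) :
    genBinom ((o : ℚ) / 2 ^ e) r ≠ 0 ∧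
      padicValRat 2 (genBinom ((o : ℚ) / 2 ^ e) r) =
        -((e * r + padicValNat 2 r.factorial : ℕ) : ℤ) := by
  have key : ∏ p ∈ Finset.range r, ((o : ℚ) / 2 ^ e - p) ≠ 0 ∧
      padicValRat 2 (∏ p ∈ Finset.range r, ((o : ℚ) / 2 ^ e - p)) = -((e * r : ℕ) : ℤ) := by
    induction r with
    | zero => simp
    | succ r ih =>
      have hodd : Odd (o - 2 ^ e * r) :=
        ho.sub_even (((even_two (α := ℤ)).pow_of_ne_zero he).mul_right _)
      have heq : (o : ℚ) / 2 ^ e - r = ((o - 2 ^ e * r : ℤ) : ℚ) / 2 ^ e := by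
        push_cast
        field_simp
      have hv := padicValRat_two_odd_div hodd e
      rw [← heq] at hv
      have hne : (o : ℚ) / 2 ^ e - r ≠ 0 := by
        intro h
        rw [h] at hv
        simp at hv
        omega
      rw [Finset.prod_range_succ]
      refine ⟨mul_ne_zero ih.1 hne, ?_⟩
      rw [padicValRat.mul ih.1 hne, ih.2, hv]
      push_cast
      ring
  have hf : (r.factorial : ℚ) ≠ 0 := by exact_mod_cast Nat.factorial_ne_zero r
  refine ⟨div_ne_zero key.1 hf, ?_⟩
  rw [genBinom, padicValRat.div key.1 hf, key.2, padicValRat.of_nat]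
  push_cast
  ring

lemma genBinom_intCast (a : ℤ) (r : ℕ) : genBinom (a : ℚ) r = ((Ring.choose a r : ℤ) : ℚ) := by
  have hf : (r.factorial : ℚ) ≠ 0 := by exact_mod_cast Nat.factorial_ne_zero r
  rw [genBinom, div_eq_iff hf]
  have h := Ring.descPochhammer_eq_factorial_smul_choose a r
  rw [← Polynomial.eval_eq_smeval, descPochhammer_eval_eq_prod_range] at h
  have h' := congrArg (Int.cast : ℤ → ℚ) h
  push_cast [nsmul_eq_mul] at h'
  rw [h', mul_comm]

lemma padicValRat_genBinom_intCast_nonneg (a : ℤ) (r : ℕ) :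
    0 ≤ padicValRat 2 (genBinom (a : ℚ) r) := by
  rw [genBinom_intCast, padicValRat.of_int]
  positivity

lemma exists_odd_alphaF_eq {n m : ℕ} (h4 : m % 4 = 2) (j : Fin n → ℕ) (K : Fin n) :
    ∃ o : ℤ, Odd o ∧ alphaF n m j K = (o : ℚ) / 2 ^ (n - 1 - (K : ℕ)) := by
  have hK := K.2
  refine ⟨(m / 2 : ℕ) - ∑ I : Fin n,
    if (I : ℕ) < (K : ℕ) then 2 ^ (n - 1 - (I : ℕ)) * (j I : ℤ) else 0, ?_, ?_⟩
  · refine Odd.sub_even ?_ (Finset.even_sum _ fun I _ => ?_)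
    · rw [Int.odd_coe_nat, Nat.odd_iff]
      omega
    · split_ifs with h
      · exact ((even_two (α := ℤ)).pow_of_ne_zero (by omega)).mul_right _
      · exact Even.zero
  · have hm : (m : ℚ) = 2 * ((m / 2 : ℕ) : ℚ) := by
      have : m = 2 * (m / 2) := by omega
      exact_mod_cast this
    have hn : n - (K : ℕ) = n - 1 - K + 1 := by omega
    rw [alphaF, Int.cast_sub, sub_div]
    congr 1
    · rw [hm, hn, pow_succ, Int.cast_natCast]
      field_simp
    · push_cast
      rw [Finset.sum_div]
      refine Finset.sum_congr rfl fun I _ => ?_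
      split_ifs with h
      · have hI : n - 1 - (I : ℕ) = (K - I) + (n - 1 - K) := by omega
        rw [hI, pow_add]
        field_simp
      · simp

/-- The term `(i - 1) x + ν(x!)` with `i - 1 ≥ 2`, against the weight `2 ^ i - 1`. -/
lemma two_mul_add_three_le_weight {e : ℕ} (he : 2 ≤ e) (r : ℕ) :
    (2 * (e * r + padicValNat 2 r.factorial) = 0 ∧ (2 ^ (e + 1) - 1) * r = 0) ∨
      2 * (e * r + padicValNat 2 r.factorial) + 3 ≤ (2 ^ (e + 1) - 1) * r := by
  rcases Nat.eq_zero_or_pos r with rfl | hr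
  · simp
  · right
    have h1 := padicValNat_factorial_lt_of_ne_zero (p := 2) hr.ne'
    have h2 : 2 * e + 3 ≤ 2 ^ (e + 1) - 1 := by
      have : 2 * e + 4 ≤ 2 ^ (e + 1) := by
        induction e, he using Nat.le_induction with
        | base => norm_num
        | succ e he ih => rw [pow_succ]; omega
      omega
    nlinarith [Nat.mul_le_mul_right r h2]

lemma padicValRat_genBinom_alphaF_castSucc {n m : ℕ} (h4 : m % 4 = 2) (j : Fin (n + 1) → ℕ)
    (k : Fin n) :
    genBinom (alphaF (n + 1) m j k.castSucc) (j k.castSucc) ≠ 0 ∧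
      padicValRat 2 (genBinom (alphaF (n + 1) m j k.castSucc) (j k.castSucc)) =
        -(((n - (k : ℕ)) * j k.castSucc + padicValNat 2 (j k.castSucc).factorial : ℕ) : ℤ) := by
  obtain ⟨o, ho, h⟩ := exists_odd_alphaF_eq h4 j k.castSucc
  have hk := k.2
  rw [h]
  simpa using padicValRat_genBinom_odd_div (e := n - k) ho (by omega) (j k.castSucc)

lemma Pprod_ne_zero_iff {n m : ℕ} (h4 : m % 4 = 2) (j : Fin (n + 1) → ℕ) :
    Pprod (n + 1) m j ≠ 0 ↔
      genBinom (alphaF (n + 1) m j (Fin.last n)) (j (Fin.last n)) ≠ 0 := by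
  rw [Pprod, Fin.prod_univ_castSucc, mul_ne_zero_iff, and_iff_right]
  exact Finset.prod_ne_zero_iff.2 fun k _ => (padicValRat_genBinom_alphaF_castSucc h4 j k).1

lemma V_eq {n m : ℕ} (h4 : m % 4 = 2) (j : Fin (n + 1) → ℕ) (hP : Pprod (n + 1) m j ≠ 0) :
    V (n + 1) m j =
      ((∑ k : Fin n, ((n - (k : ℕ)) * j k.castSucc +
        padicValNat 2 (j k.castSucc).factorial) : ℕ) : ℤ) -
      padicValRat 2 (genBinom (alphaF (n + 1) m j (Fin.last n)) (j (Fin.last n))) := by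
  rw [V, Pprod, padicValRat_prod 2 _ _ (Finset.prod_ne_zero_iff.1 hP), Fin.sum_univ_castSucc,
    Finset.sum_congr rfl fun k _ => (padicValRat_genBinom_alphaF_castSucc h4 j k).2,
    Finset.sum_neg_distrib, Nat.cast_sum]
  ring

lemma V_le {n m : ℕ} (h4 : m % 4 = 2) (j : Fin (n + 1) → ℕ) (hP : Pprod (n + 1) m j ≠ 0) :
    V (n + 1) m j ≤ ((∑ k : Fin n, ((n - (k : ℕ)) * j k.castSucc +
      padicValNat 2 (j k.castSucc).factorial) : ℕ) : ℤ) := by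
  obtain ⟨o, -, h⟩ := exists_odd_alphaF_eq h4 j (Fin.last n)
  have h0 := padicValRat_genBinom_intCast_nonneg o (j (Fin.last n))
  rw [V_eq h4 j hP, h]
  simpa using h0

lemma V_eq_of_last_eq_one {n m : ℕ} (h4 : m % 4 = 2) (j : Fin (n + 1) → ℕ)
    (hj : j (Fin.last n) = 1) :
    Pprod (n + 1) m j ≠ 0 ∧
      V (n + 1) m j = ((∑ k : Fin n, ((n - (k : ℕ)) * j k.castSucc +
        padicValNat 2 (j k.castSucc).factorial) : ℕ) : ℤ) := by
  obtain ⟨o, ho, h⟩ := exists_odd_alphaF_eq h4 j (Fin.last n)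
  have hg : genBinom (alphaF (n + 1) m j (Fin.last n)) (j (Fin.last n)) = (o : ℚ) / 2 ^ 0 := by
    rw [hj, h]
    simp [genBinom]
  have hP : Pprod (n + 1) m j ≠ 0 := by
    rw [Pprod_ne_zero_iff h4, hg]
    have : o ≠ 0 := by rintro rfl; simp at ho
    simpa using this
  refine ⟨hP, ?_⟩
  rw [V_eq h4 j hP, hg, padicValRat_two_odd_div ho]
  simp

/-- If `m ≡ 2 mod 4` and `m + 1 ≡ 1 mod 3`, then the tuple
`j* = (0, …, 0, m/3, 1)` lies in `J`, `P(j*) ≠ 0`, and every other `j ∈ J` has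
`P(j) = 0` or `V(j) < V(j*)`. -/
theorem stmt11 (n m : ℕ) (hn : 3 ≤ n) (hm : 1 ≤ m) (hmn : m ≤ 2 ^ (n + 1) - 3)
    (h4 : m % 4 = 2) (h3 : (m + 1) % 3 = 1)
    (jst : Fin n → ℕ)
    (hjst : jst = fun k : Fin n =>
      if (k : ℕ) = n - 2 then m / 3 else if (k : ℕ) = n - 1 then 1 else 0) :
    inJ n m jst ∧ Pprod n m jst ≠ 0 ∧
      ∀ j : Fin n → ℕ, inJ n m j → j ≠ jst →
        Pprod n m j = 0 ∨ V n m j < V n m jst := by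
  obtain ⟨t, rfl⟩ : ∃ t, n = t + 2 := ⟨n - 2, by omega⟩
  obtain ⟨M, rfl⟩ : ∃ M, m = 3 * M := ⟨m / 3, by omega⟩
  have hrest : ∀ k : Fin t, jst k.castSucc.castSucc = 0 := by
    intro k
    have hk := k.2
    simp only [hjst, Fin.val_castSucc]
    rw [if_neg (by omega), if_neg (by omega)]
  have hmid : jst (Fin.last t).castSucc = M := by
    simp [hjst]
  have hlast : jst (Fin.last (t + 1)) = 1 := by
    simp [hjst]
  obtain ⟨hP, hV⟩ := V_eq_of_last_eq_one h4 jst hlast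
  refine ⟨?_, hP, fun j hj hne => or_iff_not_imp_left.2 fun hPj => ?_⟩
  · simp [inJ, Fin.sum_univ_castSucc, hrest, hmid, hlast]
  refine (V_le h4 j hPj).trans_lt ?_
  rw [hV]
  norm_cast
  simp only [inJ, Fin.sum_univ_castSucc, Fin.val_castSucc, Fin.val_last] at hj
  simp only [Fin.sum_univ_castSucc, Fin.val_castSucc, Fin.val_last, hrest, hmid]
  have hterm : ∀ k ∈ (Finset.univ : Finset (Fin t)), _ := fun k _ =>
    two_mul_add_three_le_weight (e := t + 1 - (k : ℕ)) (by have := k.2; omega)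
      (j k.castSucc.castSucc)
  have hsum := sum_eq_zero_or_sum_add_three_le _ _ _ hterm
  rw [← Finset.mul_sum] at hsum
  have hW : ∑ k : Fin t, (2 ^ (t + 1 - (k : ℕ) + 1) - 1) * j k.castSucc.castSucc =
      ∑ k : Fin t, (2 ^ (t + 2 - (k : ℕ)) - 1) * j k.castSucc.castSucc := by
    refine Finset.sum_congr rfl fun k _ => ?_
    rw [show t + 1 - (k : ℕ) + 1 = t + 2 - k by have := k.2; omega]
  rw [hW] at hsum
  have hzero : ∑ k : Fin t, (2 ^ (t + 2 - (k : ℕ)) - 1) * j k.castSucc.castSucc = 0 →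
      ∀ k : Fin t, j k.castSucc.castSucc = 0 := by
    intro h k
    have hk := Finset.sum_eq_zero_iff.1 h k (Finset.mem_univ k)
    have hpow : 1 < 2 ^ (t + 2 - (k : ℕ)) := Nat.one_lt_two_pow (by have := k.2; omega)
    rcases Nat.mul_eq_zero.1 hk with h' | h'
    · omega
    · exact h'
  have hstar : (∀ k : Fin t, j k.castSucc.castSucc = 0) → j (Fin.last t).castSucc = M →
      j (Fin.last (t + 1)) = 1 → False := by
    intro h1 h2 h3
    refine hne (funext fun k => ?_)
    induction k using Fin.lastCases with
    | last => rw [h3, hlast]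
    | cast k =>
      induction k using Fin.lastCases with
      | last => rw [h2, hmid]
      | cast k => rw [h1, hrest]
  rw [show t + 2 - t = 2 by omega, show t + 2 - (t + 1) = 1 by omega] at hj
  rw [show t + 1 - t = 1 by omega]
  generalize ∑ k : Fin t, (2 ^ (t + 2 - (k : ℕ)) - 1) * j k.castSucc.castSucc = W at *
  generalize ∑ k : Fin t, ((t + 1 - (k : ℕ)) * j k.castSucc.castSucc +
    padicValNat 2 (j k.castSucc.castSucc).factorial) = T at *
  generalize j (Fin.last (t + 1)) = x at *
  generalize j (Fin.last t).castSucc = y at *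
  norm_num at hj
  obtain ⟨N, rfl⟩ : ∃ N, M = y + N := ⟨M - y, by omega⟩
  have hadd := padicValNat_two_factorial_add_le y N
  have hlow := le_two_mul_padicValNat_two_factorial_add_one N
  simp only [mul_zero, Nat.factorial_zero, padicValNat_one_right, add_zero, Finset.sum_const_zero,
    zero_add, one_mul]
  rcases hsum with ⟨hT, hW0⟩ | hTW
  · have hN : N ≠ 0 := by
      rintro rfl
      exact hstar (hzero hW0) rfl (by omega)
    omega
  · omega
end
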